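/- Let E be a real Banach space and Λ : E → E a bounded linear operator. Let δ > 0 and ρ ∈ (0,1] satisfy ‖id − δΛ‖ ≤ 1 − ρ in operator norm. Suppose Δ_k ∈ E (k ≥ 1), ξ ∈ E, ω_k ∈ E satisfy Δ_{k+1} = (id − δΛ)Δ_k − δξ + δω_k with ‖ω_k‖ ≤ ε for all k ≥ 1. Then Λ is invertible and for every integer k* ≥ 0 and every integer T ≥ 1: ‖(1/T)·Σ_{t=1}^{T} Δ_{k*+t} + Λ⁻¹ξ‖ ≤ ((1−ρ)^{k*}/(Tρ))·‖Δ_1 + Λ⁻¹ξ‖ + δε/ρ. -/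

import Mathlib

/-- If `‖v (k + 1)‖ ≤ (1 - ρ) ‖v k‖ + b` for `k ≥ 1`, the sequence decays geometrically up to the
level `b / ρ`. -/
theorem norm_le_geometric_add {E : Type*} [SeminormedAddCommGroup E] {v : ℕ → E} {ρ b : ℝ}
    (hρ0 : 0 < ρ) (hρ1 : ρ ≤ 1) (hb : 0 ≤ b)
    (hv : ∀ k, 1 ≤ k → ‖v (k + 1)‖ ≤ (1 - ρ) * ‖v k‖ + b) (k : ℕ) :
    ‖v (k + 1)‖ ≤ (1 - ρ) ^ k * ‖v 1‖ + b / ρ := by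
  induction k with
  | zero => simpa using div_nonneg hb hρ0.le
  | succ k ih =>
    calc ‖v (k + 1 + 1)‖ ≤ (1 - ρ) * ‖v (k + 1)‖ + b := hv (k + 1) (by omega)
      _ ≤ (1 - ρ) * ((1 - ρ) ^ k * ‖v 1‖ + b / ρ) + b := by
        gcongr
      _ = (1 - ρ) ^ (k + 1) * ‖v 1‖ + b / ρ := by
        field_simp
        ring

/-- A block of `T` consecutive terms of such a sequence, starting after `m` steps. -/
theorem norm_sum_le_geometric_add {E : Type*} [SeminormedAddCommGroup E] {v : ℕ → E} {ρ b : ℝ}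
    (hρ0 : 0 < ρ) (hρ1 : ρ ≤ 1) (hb : 0 ≤ b)
    (hv : ∀ k, 1 ≤ k → ‖v (k + 1)‖ ≤ (1 - ρ) * ‖v k‖ + b) (m T : ℕ) :
    ‖∑ t ∈ Finset.Icc 1 T, v (m + t)‖ ≤ (1 - ρ) ^ m / ρ * ‖v 1‖ + T * (b / ρ) := by
  have hq : 0 ≤ 1 - ρ := by linarith
  have key : ‖∑ t ∈ Finset.Icc 1 T, v (m + t)‖ ≤
      ((1 - ρ) ^ m - (1 - ρ) ^ (m + T)) / ρ * ‖v 1‖ + T * (b / ρ) := by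
    induction T with
    | zero => simp
    | succ T ih =>
      rw [Finset.sum_Icc_succ_top (by omega)]
      refine (norm_add_le_of_le ih
        (norm_le_geometric_add hρ0 hρ1 hb hv (m + T))).trans_eq ?_
      push_cast
      field_simp
      ring
  refine key.trans ?_
  gcongr
  exact sub_le_self _ (pow_nonneg hq _)

/-- Deterministic skeleton of Theorem 8 (averaged KMBGD estimator): under the perturbed linear
recursion `Δ_{k+1} = (id − δΛ)Δ_k − δξ + δω_k` with `‖id − δΛ‖ ≤ 1 − ρ` and `‖ω_k‖ ≤ ε`, the
operator `Λ` is invertible and the Polyak–Ruppert average after `k*` burn-in iterations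
satisfies `‖(1/T)Σ_{t=1}^T Δ_{k*+t} + Λ⁻¹ξ‖ ≤ ((1−ρ)^{k*}/(Tρ))‖Δ_1 + Λ⁻¹ξ‖ + δε/ρ`. -/
theorem stmt2 {E : Type*} [NormedAddCommGroup E] [NormedSpace ℝ E] [CompleteSpace E]
    (Λ : E →L[ℝ] E) (δ ρ ε : ℝ) (hδ : 0 < δ) (hρ0 : 0 < ρ) (hρ1 : ρ ≤ 1)
    (hcontr : ‖ContinuousLinearMap.id ℝ E - δ • Λ‖ ≤ 1 - ρ)
    (Δ : ℕ → E) (ξ : E) (ω : ℕ → E)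
    (hrec : ∀ k, 1 ≤ k →
      Δ (k + 1) = (ContinuousLinearMap.id ℝ E - δ • Λ) (Δ k) - δ • ξ + δ • ω k)
    (hω : ∀ k, 1 ≤ k → ‖ω k‖ ≤ ε) :
    ∃ Λinv : E →L[ℝ] E,
      Λ.comp Λinv = ContinuousLinearMap.id ℝ E ∧
      Λinv.comp Λ = ContinuousLinearMap.id ℝ E ∧
      ∀ kstar : ℕ, ∀ T : ℕ, 1 ≤ T →
        ‖(1 / (T : ℝ)) • ∑ t ∈ Finset.Icc 1 T, Δ (kstar + t) + Λinv ξ‖ ≤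
          ((1 - ρ) ^ kstar / ((T : ℝ) * ρ)) * ‖Δ 1 + Λinv ξ‖ + δ * ε / ρ := by
  have hunit : IsUnit Λ := by
    have h : IsUnit (δ • Λ) := by
      have := isUnit_one_sub_of_norm_lt_one (hcontr.trans_lt (by linarith : 1 - ρ < 1))
      rwa [← ContinuousLinearMap.one_def, sub_sub_cancel] at this
    exact (isUnit_smul_iff (Units.mk0 δ hδ.ne') Λ).mp h
  obtain ⟨u, rfl⟩ := hunit
  refine ⟨(↑u⁻¹ : E →L[ℝ] E), u.mul_inv, u.inv_mul, fun m T hT => ?_⟩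
  set x : E := (↑u⁻¹ : E →L[ℝ] E) ξ
  have hx : (u : E →L[ℝ] E) x = ξ := DFunLike.congr_fun u.mul_inv ξ
  have hε : 0 ≤ ε := (norm_nonneg _).trans (hω 1 le_rfl)
  have hv : ∀ k, 1 ≤ k → ‖Δ (k + 1) + x‖ ≤ (1 - ρ) * ‖Δ k + x‖ + δ * ε := by
    intro k hk
    have hstep : Δ (k + 1) + x =
        (ContinuousLinearMap.id ℝ E - δ • (u : E →L[ℝ] E)) (Δ k + x) + δ • ω k := by
      rw [hrec k hk, map_add]
      simp only [sub_apply, smul_apply,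
        ContinuousLinearMap.id_apply, hx]
      abel
    rw [hstep]
    refine norm_add_le_of_le (ContinuousLinearMap.le_of_opNorm_le _ hcontr _) ?_
    rw [norm_smul, Real.norm_of_nonneg hδ.le]
    exact mul_le_mul_of_nonneg_left (hω k hk) hδ.le
  have hT0 : (0 : ℝ) < T := by exact_mod_cast hT
  have havg : (1 / (T : ℝ)) • ∑ t ∈ Finset.Icc 1 T, Δ (m + t) + x =
      (1 / (T : ℝ)) • ∑ t ∈ Finset.Icc 1 T, (Δ (m + t) + x) := by
    rw [Finset.sum_add_distrib, smul_add, Finset.sum_const, Nat.card_Icc, Nat.add_sub_cancel,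
      ← Nat.cast_smul_eq_nsmul ℝ, smul_smul, one_div_mul_cancel hT0.ne', one_smul]
  rw [havg, norm_smul, Real.norm_of_nonneg (by positivity)]
  refine (mul_le_mul_of_nonneg_left (norm_sum_le_geometric_add (v := fun k => Δ k + x)
    hρ0 hρ1 (mul_nonneg hδ.le hε) hv m T) (by positivity)).trans_eq ?_
  field_simp
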